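/- The Clebsch diagonal cubic admits no twistor structure with five twistor lines: for every ℂ-linear automorphism g of ℂ⁴, the number of 2-dimensional ℂ-subspaces W of ℂ⁴ with (g ∘ j ∘ g⁻¹)(W) = W on which the polynomial z₁³ + z₂³ + z₃³ + z₄³ − (z₁ + z₂ + z₃ + z₄)³ vanishes identically is at most 4. -/

import Mathlib

noncomputable section

open MvPolynomial

/-- The standard twistor structure `j : ℂ⁴ → ℂ⁴`,
`j(z₁,z₂,z₃,z₄) = (−z̄₂, z̄₁, −z̄₄, z̄₃)`. -/
def J : (Fin 4 → ℂ) → (Fin 4 → ℂ) :=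
  fun z => ![-(starRingEnd ℂ) (z 1), (starRingEnd ℂ) (z 0),
             -(starRingEnd ℂ) (z 3), (starRingEnd ℂ) (z 2)]

/-- A line in `ℙ³(ℂ)`: a 2-dimensional `ℂ`-subspace of `ℂ⁴`. -/
def IsLine (W : Submodule ℂ (Fin 4 → ℂ)) : Prop := Module.finrank ℂ W = 2

/-- A twistor line: a line whose underlying subspace satisfies `j(W) = W`. -/
def IsTwistorLine (W : Submodule ℂ (Fin 4 → ℂ)) : Prop :=
  IsLine W ∧ J '' (W : Set (Fin 4 → ℂ)) = (W : Set (Fin 4 → ℂ))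

/-- A polynomial vanishes identically on a subspace. -/
def VanishesOn (f : MvPolynomial (Fin 4) ℂ) (W : Submodule ℂ (Fin 4 → ℂ)) : Prop :=
  ∀ z ∈ W, eval z f = 0

/-- The surface `{f = 0}` is nonsingular: no nonzero point of `ℂ⁴` is a common zero of
`f` and all its partial derivatives. -/
def Nonsingular (f : MvPolynomial (Fin 4) ℂ) : Prop :=
  ∀ z : Fin 4 → ℂ, z ≠ 0 → eval z f = 0 → ∃ i, eval z (pderiv i f) ≠ 0

/-- The coordinatewise complex conjugate of a vector. -/
def conjVec (z : Fin 4 → ℂ) : Fin 4 → ℂ := fun i => (starRingEnd ℂ) (z i)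

/-- The Clebsch diagonal cubic as a function on `ℂ⁴`. -/
def clebsch (z : Fin 4 → ℂ) : ℂ :=
  z 0 ^ 3 + z 1 ^ 3 + z 2 ^ 3 + z 3 ^ 3 - (z 0 + z 1 + z 2 + z 3) ^ 3

lemma isLine_span_pair {p q : Fin 4 → ℂ} (h : LinearIndependent ℂ ![p, q]) :
    IsLine (Submodule.span ℂ {p, q}) := by
  have := finrank_span_eq_card h
  rwa [Matrix.range_cons_cons_empty] at this

lemma IsLine.exists_add_smul {W : Submodule ℂ (Fin 4 → ℂ)} (hW : IsLine W) {p q : Fin 4 → ℂ}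
    (hp : p ∈ W) (hq : q ∈ W) (h : LinearIndependent ℂ ![p, q]) {x : Fin 4 → ℂ} (hx : x ∈ W) :
    ∃ a b : ℂ, a • p + b • q = x := by
  have hle : Submodule.span ℂ {p, q} ≤ W := by
    rw [Submodule.span_le]
    rintro y (rfl | rfl) <;> assumption
  have heq := Submodule.eq_of_le_of_finrank_eq hle ((isLine_span_pair h).trans hW.symm)
  rw [← heq] at hx
  exact Submodule.mem_span_pair.mp hx

/-- Two independent vectors of a line, in reduced echelon form for some pair of coordinates. -/
lemma IsLine.exists_echelon {W : Submodule ℂ (Fin 4 → ℂ)} (hW : IsLine W) :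
    ∃ i j, i ≠ j ∧ ∃ p ∈ W, ∃ q ∈ W, p i = 1 ∧ p j = 0 ∧ q i = 0 ∧ q j = 1 := by
  obtain ⟨v, hv, hv0⟩ : ∃ v ∈ W, v ≠ 0 := by
    refine Submodule.exists_mem_ne_zero_of_ne_bot ?_
    rintro rfl
    simp [IsLine] at hW
  obtain ⟨i, hi⟩ := Function.ne_iff.mp hv0
  simp only [Pi.zero_apply] at hi
  obtain ⟨w, hw, hwv⟩ : ∃ w ∈ W, w ∉ Submodule.span ℂ {v} := by
    by_contra! hle
    have h1 : Module.finrank ℂ W ≤ Module.finrank ℂ (Submodule.span ℂ {v}) :=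
      Submodule.finrank_mono hle
    rw [finrank_span_singleton hv0, hW] at h1
    omega
  have hr0 : w - (w i / v i) • v ≠ 0 := fun h =>
    hwv (Submodule.mem_span_singleton.mpr ⟨_, (sub_eq_zero.mp h).symm⟩)
  obtain ⟨j, hj⟩ := Function.ne_iff.mp hr0
  set r := w - (w i / v i) • v with hr
  have hri : r i = 0 := by simp [hr, hi]
  simp only [Pi.zero_apply] at hj
  have hij : i ≠ j := by rintro rfl; exact hj hri
  have hrW : r ∈ W := W.sub_mem hw (W.smul_mem _ hv)
  refine ⟨i, j, hij, (v i)⁻¹ • v - ((v i)⁻¹ * v j * (r j)⁻¹) • r,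
    W.sub_mem (W.smul_mem _ hv) (W.smul_mem _ hrW), (r j)⁻¹ • r, W.smul_mem _ hrW, ?_, ?_, ?_, ?_⟩
  · simp [hri, hi]
  · simp [hj]
  · simp [hri]
  · simp [hj]

lemma conj_eq_of_sq_add_self {x : ℂ} (h : x ^ 2 + x = 1) : (starRingEnd ℂ) x = x := by
  rw [Complex.conj_eq_iff_im]
  have h1 := congrArg Complex.re h
  have h2 := congrArg Complex.im h
  simp only [pow_two, Complex.add_re, Complex.mul_re, Complex.one_re, Complex.add_im,
    Complex.mul_im, Complex.one_im] at h1 h2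
  have h3 : x.im * (2 * x.re + 1) = 0 := by linarith
  rcases mul_eq_zero.mp h3 with h | h
  · exact h
  · have : x.re = -1 / 2 := by linarith
    rw [this] at h1
    nlinarith [sq_nonneg x.im]

lemma conj_eq_of_sq_eq_add_one {x : ℂ} (h : x ^ 2 = x + 1) : (starRingEnd ℂ) x = x := by
  have := conj_eq_of_sq_add_self (x := -x) (by linear_combination h)
  simpa using this

/-- The coefficients of a line on the Clebsch cubic in reduced echelon form are real. -/
lemma conj_eq_of_echelon {a b c d : ℂ}
    (h0 : (1 + a) * (1 + c) * (a + c) = 0) (h3 : (1 + b) * (1 + d) * (b + d) = 0)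
    (h1 : a ^ 2 * b + c ^ 2 * d = (1 + a + c) ^ 2 * (1 + b + d))
    (h2 : a * b ^ 2 + c * d ^ 2 = (1 + a + c) * (1 + b + d) ^ 2) :
    (starRingEnd ℂ) a = a ∧ (starRingEnd ℂ) b = b ∧
      (starRingEnd ℂ) c = c ∧ (starRingEnd ℂ) d = d := by
  have cross : ∀ b c : ℂ, b - c ^ 2 = c ^ 2 * b → c - b ^ 2 = c * b ^ 2 →
      (starRingEnd ℂ) b = b ∧ (starRingEnd ℂ) c = c := by
    intro b c h1 h2
    have h : (b - c) * ((1 + b) * (1 + c)) = 0 := by linear_combination h1 - h2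
    rcases mul_eq_zero.mp h with h | h
    · obtain rfl : b = c := by linear_combination h
      have h : b * (b ^ 2 + b - 1) = 0 := by linear_combination -h1
      rcases mul_eq_zero.mp h with rfl | h
      · simp
      · have := conj_eq_of_sq_add_self (x := b) (by linear_combination h)
        exact ⟨this, this⟩
    · rcases mul_eq_zero.mp h with h | h
      · obtain rfl : b = -1 := by linear_combination h
        exact absurd (by linear_combination -h1) (one_ne_zero (α := ℂ))
      · obtain rfl : c = -1 := by linear_combination h
        exact absurd (by linear_combination -h1) (one_ne_zero (α := ℂ))
  have mixed : ∀ c d : ℂ, d * (c ^ 2 - 1) = c ^ 2 → d ^ 2 * (c - 1) = c →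
      (starRingEnd ℂ) c = c ∧ (starRingEnd ℂ) d = d := by
    intro c d h1 h2
    by_cases hc : c = 0
    · subst hc
      have : d = 0 := by linear_combination -h1
      simp [this]
    · have h3 : c + 1 = c * d := by
        refine mul_left_cancel₀ hc ?_
        linear_combination d * h1 - (c + 1) * h2
      have h4 : (c - d) * (d - 1) = 0 := by linear_combination h2 + d * h3
      rcases mul_eq_zero.mp h4 with h | h
      · obtain rfl : c = d := by linear_combination h
        have := conj_eq_of_sq_eq_add_one (x := c) (by linear_combination -h3)
        exact ⟨this, this⟩
      · obtain rfl : d = 1 := by linear_combination h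
        exact absurd (by linear_combination h3) (one_ne_zero (α := ℂ))
  have eq_neg {x y : ℂ} (h : x + y = 0) : y = -x := by linear_combination h
  rcases mul_eq_zero.mp h0 with h | h
  · rcases mul_eq_zero.mp h with h | h
    · obtain rfl := eq_neg h
      rcases mul_eq_zero.mp h3 with h | h
      · rcases mul_eq_zero.mp h with h | h
        · obtain rfl := eq_neg h
          exact absurd (by linear_combination -h1) (one_ne_zero (α := ℂ))
        · obtain rfl := eq_neg h
          have := cross b c (by linear_combination h1) (by linear_combination h2)
          simp [this]
      · obtain rfl := eq_neg h
        have := mixed c (-b) (by linear_combination h1) (by linear_combination h2)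
        simp only [map_neg, neg_inj] at this
        simp [this]
    · obtain rfl := eq_neg h
      rcases mul_eq_zero.mp h3 with h | h
      · rcases mul_eq_zero.mp h with h | h
        · obtain rfl := eq_neg h
          have := cross d a (by linear_combination h1) (by linear_combination h2)
          simp [this]
        · obtain rfl := eq_neg h
          exact absurd (by linear_combination -h1) (one_ne_zero (α := ℂ))
      · obtain rfl := eq_neg h
        have := mixed a b (by linear_combination h1) (by linear_combination h2)
        simpa using this
  · obtain rfl := eq_neg h
    rcases mul_eq_zero.mp h3 with h | h
    · rcases mul_eq_zero.mp h with h | h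
      · obtain rfl := eq_neg h
        have := mixed d (-a) (by linear_combination h2) (by linear_combination h1)
        simp only [map_neg, neg_inj] at this
        simp [this]
      · obtain rfl := eq_neg h
        have := mixed b a (by linear_combination h2) (by linear_combination h1)
        simp [this]
    · obtain rfl := eq_neg h
      exact absurd (by linear_combination -h1) (one_ne_zero (α := ℂ))

/-- All lines on the Clebsch cubic are real. -/
lemma IsLine.conjVec_mem {W : Submodule ℂ (Fin 4 → ℂ)} (hW : IsLine W)
    (hf : ∀ z ∈ W, clebsch z = 0) {x : Fin 4 → ℂ} (hx : x ∈ W) : conjVec x ∈ W := by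
  obtain ⟨i, j, hij, p, hp, q, hq, hpi, hpj, hqi, hqj⟩ := hW.exists_echelon
  obtain ⟨k, l, hcover, hclebsch⟩ : ∃ k l : Fin 4, (∀ m, m = i ∨ m = j ∨ m = k ∨ m = l) ∧
      ∀ z, clebsch z = z i ^ 3 + z j ^ 3 + z k ^ 3 + z l ^ 3 - (z i + z j + z k + z l) ^ 3 := by
    obtain ⟨k, l, hik, hil, hjk, hjl, hkl⟩ : ∃ k l : Fin 4,
        i ≠ k ∧ i ≠ l ∧ j ≠ k ∧ j ≠ l ∧ k ≠ l := by
      clear hpi hpj hqi hqj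
      revert i j
      decide
    have huniv : ∀ m, m = i ∨ m = j ∨ m = k ∨ m = l := by omega
    have hsum : ∀ g : Fin 4 → ℂ, g 0 + g 1 + g 2 + g 3 = g i + g j + g k + g l := by
      intro g
      have hu : (Finset.univ : Finset (Fin 4)) = {i, j, k, l} := by
        ext m
        simpa using huniv m
      have := Fin.sum_univ_four g
      rw [← this, hu, Finset.sum_insert (by simp [*]), Finset.sum_insert (by simp [*]),
        Finset.sum_insert (by simp [*]), Finset.sum_singleton]
      ring
    refine ⟨k, l, huniv, fun z => ?_⟩
    rw [clebsch, hsum z, hsum fun m => z m ^ 3]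
  have hcub : ∀ s t : ℂ, s ^ 3 + t ^ 3 + (s * p k + t * q k) ^ 3 + (s * p l + t * q l) ^ 3
      - (s + t + (s * p k + t * q k) + (s * p l + t * q l)) ^ 3 = 0 := by
    intro s t
    have := hf _ (W.add_mem (W.smul_mem s hp) (W.smul_mem t hq))
    simpa [hclebsch, hpi, hpj, hqi, hqj] using this
  have e10 := hcub 1 0
  have e01 := hcub 0 1
  have e11 := hcub 1 1
  have e1n := hcub 1 (-1)
  obtain ⟨ha, hb, hc, hd⟩ := conj_eq_of_echelon (a := p k) (b := q k) (c := p l) (d := q l)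
    (by linear_combination (-1 / 3) * e10) (by linear_combination (-1 / 3) * e01)
    (by linear_combination (1 / 6) * (e11 - e1n - 2 * e01))
    (by linear_combination (1 / 6) * (e11 + e1n - 2 * e10))
  have hli : LinearIndependent ℂ ![p, q] := by
    rw [LinearIndependent.pair_iff]
    intro s t h
    have h1 := congrFun h i
    have h2 := congrFun h j
    simp_all
  obtain ⟨s, t, rfl⟩ := hW.exists_add_smul hp hq hli hx
  have : conjVec (s • p + t • q) = (starRingEnd ℂ) s • p + (starRingEnd ℂ) t • q := by
    ext m
    rcases hcover m with rfl | rfl | rfl | rfl <;> simp [conjVec, *]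
  rw [this]
  exact W.add_mem (W.smul_mem _ hp) (W.smul_mem _ hq)

/-- Four pairwise skew lines have a common transversal, here the one spanned by `u` and `w`. -/
lemma exists_transversal {W : Fin 4 → Submodule ℂ (Fin 4 → ℂ)} (hW : ∀ i, IsLine (W i))
    (hd : ∀ i j, i ≠ j → Disjoint (W i) (W j)) :
    ∃ u ∈ W 0, ∃ w ∈ W 1, ∃ c : ℂ, w ≠ 0 ∧ u + w ∈ W 2 ∧ c • u + w ∈ W 3 := by
  have hrank (i j : Fin 4) : Module.finrank ℂ (W i) = Module.finrank ℂ (W j) :=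
    (hW i).trans (hW j).symm
  have hcompl : IsCompl (W 0) (W 1) := by
    refine ⟨hd 0 1 (by decide), codisjoint_iff.mpr (Submodule.eq_top_of_finrank_eq ?_)⟩
    have := Submodule.finrank_sup_add_finrank_inf_eq (W 0) (W 1)
    rw [(hd 0 1 (by decide)).eq_bot, finrank_bot, hW 0, hW 1] at this
    simpa using this
  let p₀ := (W 0).projectionOnto (W 1) hcompl
  let p₁ := (W 1).projectionOnto (W 0) hcompl.symm
  have hsplit (x : Fin 4 → ℂ) : (p₀ x : Fin 4 → ℂ) + p₁ x = x := by
    simpa [p₀, p₁] using Submodule.projection_add_projection_eq_self hcompl x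
  have hinj₀ (i : Fin 4) (hi : i ≠ 1) : Function.Injective (p₀ ∘ₗ (W i).subtype) := by
    rw [← LinearMap.ker_eq_bot, LinearMap.ker_comp, Submodule.ker_projectionOnto]
    exact (Submodule.disjoint_iff_comap_eq_bot).mp (hd i 1 hi)
  have hinj₁ (i : Fin 4) (hi : i ≠ 0) : Function.Injective (p₁ ∘ₗ (W i).subtype) := by
    rw [← LinearMap.ker_eq_bot, LinearMap.ker_comp, Submodule.ker_projectionOnto]
    exact (Submodule.disjoint_iff_comap_eq_bot).mp (hd i 0 hi)
  let e₂ := LinearEquiv.ofInjectiveOfFinrankEq _ (hinj₁ 2 (by decide)) (hrank 2 1)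
  let e₃ := LinearEquiv.ofInjectiveOfFinrankEq _ (hinj₁ 3 (by decide)) (hrank 3 1)
  let f₂ := LinearEquiv.ofInjectiveOfFinrankEq _ (hinj₀ 2 (by decide)) (hrank 2 0)
  have : Nontrivial (W 2) := Module.nontrivial_of_finrank_pos (R := ℂ) (by rw [hW 2]; norm_num)
  obtain ⟨c, hc⟩ := Module.End.exists_eigenvalue
    (f₂.symm.toLinearMap ∘ₗ (p₀ ∘ₗ (W 3).subtype) ∘ₗ e₃.symm.toLinearMap ∘ₗ e₂.toLinearMap)
  obtain ⟨x, hx⟩ := hc.exists_hasEigenvector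
  have hx1 := hx.apply_eq_smul
  set y := e₃.symm (e₂ x)
  have hy0 : p₀ y = c • p₀ x := by
    have := congrArg f₂ hx1
    rwa [LinearMap.comp_apply, LinearEquiv.coe_coe, LinearEquiv.apply_symm_apply, map_smul] at this
  have hy1 : p₁ y = p₁ x := e₃.apply_symm_apply (e₂ x)
  refine ⟨p₀ x, (p₀ x).2, p₁ x, (p₁ x).2, c, ?_, ?_, ?_⟩
  · intro h
    refine hx.2 (e₂.injective ?_)
    rw [map_zero]
    exact Subtype.ext h
  · rw [hsplit]
    exact x.2
  · rw [← Submodule.coe_smul, ← hy0, ← hy1, hsplit]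
    exact y.2

lemma conjVec_add (x y : Fin 4 → ℂ) : conjVec (x + y) = conjVec x + conjVec y := by
  ext i
  simp [conjVec]

lemma conjVec_smul (c : ℂ) (x : Fin 4 → ℂ) :
    conjVec (c • x) = (starRingEnd ℂ) c • conjVec x := by
  ext i
  simp [conjVec]

lemma conjVec_eq_zero {x : Fin 4 → ℂ} (h : conjVec x = 0) : x = 0 := by
  ext i
  simpa [conjVec] using congrFun h i

/-- A line meeting the cubic in four distinct points lies on it. -/
lemma clebsch_eq_zero_of_four {u w : Fin 4 → ℂ} {c : ℂ} (hu : clebsch u = 0) (hw : clebsch w = 0)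
    (h2 : clebsch (u + w) = 0) (h3 : clebsch (c • u + w) = 0) (hc0 : c ≠ 0) (hc1 : c ≠ 1)
    (s t : ℂ) : clebsch (s • u + t • w) = 0 := by
  obtain ⟨β, γ, h⟩ : ∃ β γ : ℂ, ∀ s t : ℂ, clebsch (s • u + t • w) =
      s ^ 3 * clebsch u + s ^ 2 * t * β + s * t ^ 2 * γ + t ^ 3 * clebsch w := by
    refine ⟨3 * (u 0 ^ 2 * w 0 + u 1 ^ 2 * w 1 + u 2 ^ 2 * w 2 + u 3 ^ 2 * w 3
        - (u 0 + u 1 + u 2 + u 3) ^ 2 * (w 0 + w 1 + w 2 + w 3)),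
      3 * (u 0 * w 0 ^ 2 + u 1 * w 1 ^ 2 + u 2 * w 2 ^ 2 + u 3 * w 3 ^ 2
        - (u 0 + u 1 + u 2 + u 3) * (w 0 + w 1 + w 2 + w 3) ^ 2), fun s t => ?_⟩
    simp only [clebsch, Pi.add_apply, Pi.smul_apply, smul_eq_mul]
    ring
  have e2 := h 1 1
  have e3 := h c 1
  simp only [one_smul, hu, hw, h2, h3] at e2 e3
  have hβ : (c * (c - 1)) * β = 0 := by linear_combination c * e2 - e3
  have hβ : β = 0 := by
    simpa [hc0, sub_eq_zero, hc1] using hβ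
  have hγ : γ = 0 := by linear_combination -e2 - hβ
  rw [h, hu, hw, hβ, hγ]
  ring

/-- The common transversals of four skew lines on the Clebsch cubic are real, and so is the
parameter of the fourth point on them. -/
lemma transversal_real {W : Fin 4 → Submodule ℂ (Fin 4 → ℂ)} (hW : ∀ i, IsLine (W i))
    (hd : ∀ i j, i ≠ j → Disjoint (W i) (W j)) (hf : ∀ i, ∀ z ∈ W i, clebsch z = 0)
    {u w : Fin 4 → ℂ} {c : ℂ} (hu : u ∈ W 0) (hw : w ∈ W 1) (hw0 : w ≠ 0) (h2 : u + w ∈ W 2)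
    (h3 : c • u + w ∈ W 3) :
    (starRingEnd ℂ) c = c ∧ ∃ μ : ℂ, μ ≠ 0 ∧ conjVec w = μ • w := by
  have hzero {i j : Fin 4} (hij : i ≠ j) {x : Fin 4 → ℂ} (hi : x ∈ W i) (hj : x ∈ W j) : x = 0 :=
    Submodule.disjoint_def.mp (hd i j hij) x hi hj
  have hu0 : u ≠ 0 := by
    rintro rfl
    exact hw0 (hzero (i := 1) (j := 2) (by decide) hw (by simpa using h2))
  have hc0 : c ≠ 0 := by
    rintro rfl
    exact hw0 (hzero (i := 1) (j := 3) (by decide) hw (by simpa using h3))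
  have hc1 : c ≠ 1 := by
    rintro rfl
    have h := hzero (i := 2) (j := 3) (by decide) h2 (by simpa using h3)
    refine hw0 (hzero (i := 0) (j := 1) (by decide) ?_ hw)
    rw [eq_neg_of_add_eq_zero_right h]
    exact (W 0).neg_mem hu
  have hli : LinearIndependent ℂ ![u, w] := by
    rw [LinearIndependent.pair_iff]
    intro s t h
    have ht : t • w = 0 := by
      refine hzero (i := 0) (j := 1) (by decide) ?_ ((W 1).smul_mem t hw)
      rw [eq_neg_of_add_eq_zero_right h]
      exact (W 0).neg_mem ((W 0).smul_mem s hu)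
    have hs : s • u = 0 := by simpa [ht] using h
    simpa [hu0, hw0] using And.intro hs ht
  have hL := isLine_span_pair hli
  have hfL : ∀ z ∈ Submodule.span ℂ {u, w}, clebsch z = 0 := by
    intro z hz
    obtain ⟨s, t, rfl⟩ := Submodule.mem_span_pair.mp hz
    exact clebsch_eq_zero_of_four (hf 0 u hu) (hf 1 w hw) (hf 2 _ h2) (hf 3 _ h3) hc0 hc1 s t
  have hreal (i : Fin 4) {x : Fin 4 → ℂ} (hx : x ∈ W i) : conjVec x ∈ W i :=
    (hW i).conjVec_mem (hf i) hx
  obtain ⟨ν, b, hν⟩ := Submodule.mem_span_pair.mp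
    (hL.conjVec_mem hfL (Submodule.subset_span (Set.mem_insert u {w})))
  obtain ⟨a, μ, hμ⟩ := Submodule.mem_span_pair.mp
    (hL.conjVec_mem hfL (Submodule.subset_span (Set.mem_insert_of_mem u rfl)))
  have hb : b • w = 0 := by
    refine hzero (i := 0) (j := 1) (by decide) ?_ ((W 1).smul_mem b hw)
    rw [eq_sub_of_add_eq' hν]
    exact (W 0).sub_mem (hreal 0 hu) ((W 0).smul_mem ν hu)
  have ha : a • u = 0 := by
    refine hzero (i := 0) (j := 1) (by decide) ((W 0).smul_mem a hu) ?_
    rw [eq_sub_of_add_eq hμ]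
    exact (W 1).sub_mem (hreal 1 hw) ((W 1).smul_mem μ hw)
  rw [hb, add_zero] at hν
  rw [ha, zero_add] at hμ
  have hμ0 : μ ≠ 0 := by
    rintro rfl
    exact hw0 (conjVec_eq_zero (by simpa using hμ.symm))
  have hr2 := hreal 2 h2
  have hr3 := hreal 3 h3
  rw [conjVec_add, ← hν, ← hμ] at hr2
  rw [conjVec_add, conjVec_smul, ← hν, ← hμ] at hr3
  have hνμ : ν = μ := by
    have h : (ν - μ) • u = 0 := by
      refine hzero (i := 0) (j := 2) (by decide) ((W 0).smul_mem _ hu) ?_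
      have := (W 2).sub_mem hr2 ((W 2).smul_mem μ h2)
      convert this using 1
      module
    simpa [hu0, sub_eq_zero] using h
  subst hνμ
  refine ⟨?_, ν, hμ0, hμ.symm⟩
  have h : (((starRingEnd ℂ) c - c) * ν) • u = 0 := by
    refine hzero (i := 0) (j := 3) (by decide) ((W 0).smul_mem _ hu) ?_
    have := (W 3).sub_mem hr3 ((W 3).smul_mem ν h3)
    convert this using 1
    module
  simpa [hu0, hμ0, sub_eq_zero] using h

lemma linearIndependent_antilinear {σ : (Fin 4 → ℂ) → (Fin 4 → ℂ)}
    (hsmul : ∀ (c : ℂ) x, σ (c • x) = (starRingEnd ℂ) c • σ x) (hsq : ∀ x, σ (σ x) = -x)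
    {x : Fin 4 → ℂ} (hx : x ≠ 0) :
    LinearIndependent ℂ ![x, σ x] := by
  rw [LinearIndependent.pair_iff' hx]
  intro a ha
  have h := hsq x
  rw [← ha, hsmul, ← ha, smul_smul] at h
  have h0 : ((starRingEnd ℂ) a * a + 1) • x = 0 := by
    rw [add_smul, h, one_smul, neg_add_cancel]
  have h1 : (starRingEnd ℂ) a * a + 1 = 0 := by simpa [hx] using h0
  rw [← Complex.normSq_eq_conj_mul_self] at h1
  have h2 : Complex.normSq a + 1 = 0 := by exact_mod_cast h1
  linarith [Complex.normSq_nonneg a]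

/-- Distinct twistor lines are skew. -/
lemma disjoint_of_invariant {σ : (Fin 4 → ℂ) → (Fin 4 → ℂ)}
    (hsmul : ∀ (c : ℂ) x, σ (c • x) = (starRingEnd ℂ) c • σ x) (hsq : ∀ x, σ (σ x) = -x)
    {W W' : Submodule ℂ (Fin 4 → ℂ)} (hW : IsLine W) (hW' : IsLine W')
    (hσ : ∀ x ∈ W, σ x ∈ W) (hσ' : ∀ x ∈ W', σ x ∈ W') (hne : W ≠ W') : Disjoint W W' := by
  rw [Submodule.disjoint_def]
  intro x hx hx'
  by_contra hx0
  have hli := linearIndependent_antilinear hsmul hsq hx0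
  refine hne (le_antisymm (fun y hy => ?_) (fun y hy => ?_))
  · obtain ⟨a, b, rfl⟩ := hW.exists_add_smul hx (hσ x hx) hli hy
    exact W'.add_mem (W'.smul_mem a hx') (W'.smul_mem b (hσ' x hx'))
  · obtain ⟨a, b, rfl⟩ := hW'.exists_add_smul hx' (hσ' x hx') hli hy
    exact W.add_mem (W.smul_mem a hx) (W.smul_mem b (hσ x hx))

/-- A twistor structure has no four twistor lines on the Clebsch cubic. -/
lemma clebsch_not_four_invariant {σ : (Fin 4 → ℂ) → (Fin 4 → ℂ)}
    (hadd : ∀ x y, σ (x + y) = σ x + σ y)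
    (hsmul : ∀ (c : ℂ) x, σ (c • x) = (starRingEnd ℂ) c • σ x) (hsq : ∀ x, σ (σ x) = -x)
    {W : Fin 4 → Submodule ℂ (Fin 4 → ℂ)}
    (hinj : Function.Injective W) (hW : ∀ i, IsLine (W i)) (hσ : ∀ i, ∀ x ∈ W i, σ x ∈ W i)
    (hf : ∀ i, ∀ z ∈ W i, clebsch z = 0) : False := by
  have hd (i j : Fin 4) (hij : i ≠ j) : Disjoint (W i) (W j) :=
    disjoint_of_invariant hsmul hsq (hW i) (hW j) (hσ i) (hσ j) (hinj.ne hij)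
  obtain ⟨u, hu, w, hw, c, hw0, h2, h3⟩ := exists_transversal hW hd
  have hli := linearIndependent_antilinear hsmul hsq hw0
  obtain ⟨hc, μ, hμ0, hμ⟩ := transversal_real hW hd hf hu hw hw0 h2 h3
  have hcomb (a b : ℂ) (hab : ¬(a = 0 ∧ b = 0)) :
      ∃ ρ : ℂ, ρ ≠ 0 ∧ conjVec (a • w + b • σ w) = ρ • (a • w + b • σ w) := by
    refine (transversal_real hW hd hf (u := a • u + b • σ u) (c := c)
      ((W 0).add_mem ((W 0).smul_mem a hu) ((W 0).smul_mem b (hσ 0 u hu)))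
      ((W 1).add_mem ((W 1).smul_mem a hw) ((W 1).smul_mem b (hσ 1 w hw))) ?_ ?_ ?_).2
    · intro h
      exact hab (LinearIndependent.pair_iff.mp hli a b h)
    · have h := (W 2).add_mem ((W 2).smul_mem a h2) ((W 2).smul_mem b (hσ 2 _ h2))
      rw [hadd] at h
      convert h using 1
      module
    · have h := (W 3).add_mem ((W 3).smul_mem a h3) ((W 3).smul_mem b (hσ 3 _ h3))
      rw [hadd, hsmul, hc] at h
      convert h using 1
      module
  obtain ⟨ν, -, hν⟩ := hcomb 0 1 (by simp)
  obtain ⟨ρ₁, -, h1⟩ := hcomb 1 1 (by simp)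
  obtain ⟨ρ₂, -, h2⟩ := hcomb 1 Complex.I (by simp)
  simp only [zero_smul, one_smul, zero_add] at hν
  simp only [conjVec_add, conjVec_smul, hμ, hν, one_smul, Complex.conj_I] at h1 h2
  rw [← sub_eq_zero] at h1 h2
  obtain ⟨h11, h12⟩ := LinearIndependent.pair_iff.mp hli (μ - ρ₁) (ν - ρ₁) (by rw [← h1]; module)
  obtain ⟨h21, h22⟩ := LinearIndependent.pair_iff.mp hli (μ - ρ₂) ((-ν - ρ₂) * Complex.I)
    (by rw [← h2]; module)
  have h23 : -ν - ρ₂ = 0 := by simpa using h22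
  exact hμ0 (by linear_combination (1 / 2) * (h11 - h12 + h21 - h23))

lemma J_add (x y : Fin 4 → ℂ) : J (x + y) = J x + J y := by
  ext i
  fin_cases i <;> simp [J] <;> ring

lemma J_smul (c : ℂ) (x : Fin 4 → ℂ) : J (c • x) = (starRingEnd ℂ) c • J x := by
  ext i
  fin_cases i <;> simp [J]

lemma J_J (x : Fin 4 → ℂ) : J (J x) = -x := by
  ext i
  fin_cases i <;> simp [J]

/-- The Clebsch diagonal cubic admits no twistor structure with five twistor lines: for
every twistor structure `g ∘ j ∘ g⁻¹` it contains at most 4 invariant lines. -/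
theorem Clebsch_no_five_twistor_lines (g : (Fin 4 → ℂ) ≃ₗ[ℂ] (Fin 4 → ℂ)) :
    {W : Submodule ℂ (Fin 4 → ℂ) | IsLine W ∧
      (fun z => g (J (g.symm z))) '' (W : Set (Fin 4 → ℂ)) = (W : Set (Fin 4 → ℂ)) ∧
      VanishesOn (X 0 ^ 3 + X 1 ^ 3 + X 2 ^ 3 + X 3 ^ 3
          - (X 0 + X 1 + X 2 + X 3) ^ 3 : MvPolynomial (Fin 4) ℂ) W}.encard ≤ 4 := by
  by_contra! hlt
  obtain ⟨t, hts, ht⟩ := Set.exists_subset_encard_eq hlt.le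
  have htf : t.Finite := Set.finite_of_encard_eq_coe ht
  have hcard : Nat.card t = 4 := by
    rw [Nat.card_coe_set_eq, Set.ncard, ht]
    rfl
  have := htf.to_subtype
  let e : Fin 4 ≃ t := (Finite.equivFinOfCardEq hcard).symm
  refine clebsch_not_four_invariant (σ := fun z => g (J (g.symm z))) (W := fun i => e i)
    (fun x y => ?_) (fun c x => ?_) (fun x => ?_) (Subtype.val_injective.comp e.injective)
    (fun i => (hts (e i).2).1) (fun i x hx => ?_) (fun i z hz => ?_)
  · simp [J_add]
  · simp [J_smul]
  · simp [J_J]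
  · have h := (hts (e i).2).2.1
    rw [← SetLike.mem_coe, ← h]
    exact Set.mem_image_of_mem _ hx
  · simpa [clebsch] using (hts (e i).2).2.2 z hz
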